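/- Every connected graph G on n vertices (n ≥ 3) of treewidth t ≥ 1, with arbitrary nonnegative edge weights, admits an embedding of its shortest-path metric (V, d_G) into a Hilbert space with distortion O(√(ln(t ln n) · ln n)). -/

import Mathlib

open Set

/-- The weight of a walk in an edge-weighted graph: the sum of the weights of its edges. -/
def walkWeight {V : Type*} {G : SimpleGraph V} (w : Sym2 V → ℝ) {u v : V}
    (p : G.Walk u v) : ℝ :=
  (p.edges.map w).sum

/-- The shortest-path metric `d_G` of the edge-weighted graph `(G, w)`. -/
noncomputable def graphDist {V : Type*} (G : SimpleGraph V) (w : Sym2 V → ℝ) (u v : V) : ℝ :=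
  sInf {r : ℝ | ∃ p : G.Walk u v, r = walkWeight w p}

/-- `(T, bag)` is a tree decomposition of `G`: `T` is a tree, every vertex of `G` lies in
some bag, both endpoints of every edge of `G` lie in a common bag, and for every vertex
`v` of `G` the tree nodes whose bags contain `v` form a (connected) subtree of `T`. -/
def IsTreeDecomposition {V ι : Type*} (G : SimpleGraph V) (T : SimpleGraph ι)
    (bag : ι → Finset V) : Prop :=
  T.IsTree ∧
  (∀ v : V, ∃ i, v ∈ bag i) ∧
  (∀ u v : V, G.Adj u v → ∃ i, u ∈ bag i ∧ v ∈ bag i) ∧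
  (∀ (v : V) (i j : ι), v ∈ bag i → v ∈ bag j →
    ∃ q : T.Walk i j, ∀ x ∈ q.support, v ∈ bag x)

/-- `G` admits a tree decomposition of width at most `t` (all bags of size at most `t+1`). -/
def HasTreewidthLE {V : Type*} (G : SimpleGraph V) (t : ℕ) : Prop :=
  ∃ (ι : Type) (T : SimpleGraph ι) (bag : ι → Finset V),
    IsTreeDecomposition G T bag ∧ ∀ i, (bag i).card ≤ t + 1

/-- The treewidth of `G`: the least width of a tree decomposition of `G`. -/
noncomputable def treewidth {V : Type*} (G : SimpleGraph V) : ℕ :=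
  sInf {t | HasTreewidthLE G t}

/-- The space `X` with distance function `d` embeds into some (real) Hilbert space with
distortion at most `D`: there are a Hilbert space `H`, a map `f : X → H` and a scale
`c > 0` with `c·d(x,y) ≤ ‖f x - f y‖ ≤ c·D·d(x,y)` for all `x, y`. -/
def EmbedsInHilbertWithDistortion {X : Type*} (d : X → X → ℝ) (D : ℝ) : Prop :=
  ∃ (H : Type) (i1 : NormedAddCommGroup H),
    letI := i1
    ∃ (_ : InnerProductSpace ℝ H) (_ : CompleteSpace H) (f : X → H) (c : ℝ),
      0 < c ∧ ∀ x y : X,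
        c * d x y ≤ ‖f x - f y‖ ∧ ‖f x - f y‖ ≤ c * D * d x y

section TreeSeparation

variable {ι : Type*} {T : SimpleGraph ι}

/-- The nodes of `T` that every walk from the root `r` reaches only through `i`. -/
def nodesBelow (T : SimpleGraph ι) (r i : ι) : Set ι :=
  {k | ∀ p : T.Walk r k, i ∈ p.support}

lemma mem_nodesBelow_of_isPath (hT : T.IsAcyclic) {r i k : ι} {p : T.Walk r k}
    (hp : p.IsPath) (hi : i ∈ p.support) : k ∈ nodesBelow T r i := by
  classical
  intro q
  have h := (hT.subsingleton_path _ _).elim ⟨p, hp⟩ ⟨q.bypass, q.bypass_isPath⟩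
  have h' : p = q.bypass := congrArg Subtype.val h
  exact q.support_bypass_subset_support (h' ▸ hi)

lemma eq_of_adj_of_notMem_nodesBelow (hT : T.IsAcyclic) {r i j a b : ι} (hij : T.Adj i j)
    (p : T.Walk r i) (hp : j ∉ p.support) (ha : a ∈ nodesBelow T r j)
    (hb : b ∉ nodesBelow T r j) (hab : T.Adj a b) : b = i := by
  classical
  simp only [nodesBelow, mem_ofPred_eq, not_forall] at hb
  obtain ⟨q, hq⟩ := hb
  have haj : a = j := by
    have := ha (q.concat hab.symm)
    rw [SimpleGraph.Walk.support_concat] at this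
    simp only [List.mem_append, List.mem_singleton] at this
    rcases this with h | h
    · exact absurd h hq
    · exact h.symm
  subst haj
  have h1 : (q.bypass.concat hab.symm).IsPath :=
    q.bypass_isPath.concat (fun h => hq (q.support_bypass_subset_support h)) _
  have h2 : (p.bypass.concat hij).IsPath :=
    p.bypass_isPath.concat (fun h => hp (p.support_bypass_subset_support h)) _
  have h3 := congrArg Subtype.val ((hT.subsingleton_path _ _).elim ⟨_, h1⟩ ⟨_, h2⟩)
  have h4 := congrArg SimpleGraph.Walk.penultimate h3
  simpa using h4

lemma mem_nodesBelow_of_walk_avoiding (hT : T.IsAcyclic) {r i j a b : ι} (hij : T.Adj i j)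
    (p : T.Walk r i) (hp : j ∉ p.support) (ha : a ∈ nodesBelow T r j)
    (q : T.Walk a b) (hq : i ∉ q.support) : b ∈ nodesBelow T r j := by
  induction q with
  | nil => exact ha
  | cons h q ih =>
    rw [SimpleGraph.Walk.support_cons, List.mem_cons, not_or] at hq
    refine ih ?_ hq.2
    by_contra hc
    have := eq_of_adj_of_notMem_nodesBelow hT hij p hp ha hc h
    exact hq.2 (this ▸ q.start_mem_support)

end TreeSeparation

section Separator

variable {V : Type*}

/-- `u` and `v` are joined by a walk of `G` inside `B`. -/
def JoinedWithin (G : SimpleGraph V) (B : Set V) (u v : V) : Prop :=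
  ∃ p : G.Walk u v, ∀ z ∈ p.support, z ∈ B

namespace JoinedWithin

variable {G : SimpleGraph V} {B B' : Set V} {u v x : V}

lemma refl (h : u ∈ B) : JoinedWithin G B u u := ⟨.nil, by simpa using h⟩

lemma symm (h : JoinedWithin G B u v) : JoinedWithin G B v u := by
  obtain ⟨p, hp⟩ := h
  exact ⟨p.reverse, by simpa using hp⟩

lemma trans (h : JoinedWithin G B u v) (h' : JoinedWithin G B v x) : JoinedWithin G B u x := by
  obtain ⟨p, hp⟩ := h
  obtain ⟨q, hq⟩ := h'
  refine ⟨p.append q, fun z hz => ?_⟩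
  rcases (SimpleGraph.Walk.mem_support_append_iff _ _).1 hz with h | h
  exacts [hp z h, hq z h]

lemma right_mem (h : JoinedWithin G B u v) : v ∈ B := by
  obtain ⟨p, hp⟩ := h
  exact hp _ p.end_mem_support

lemma mono (hB : B ⊆ B') (h : JoinedWithin G B u v) : JoinedWithin G B' u v := by
  obtain ⟨p, hp⟩ := h
  exact ⟨p, fun z hz => hB (hp z hz)⟩

lemma of_mem_support {p : G.Walk u v} (hp : ∀ z ∈ p.support, z ∈ B) (hx : x ∈ p.support) :
    JoinedWithin G B u x := by
  classical
  exact ⟨p.takeUntil x hx, fun z hz => hp z (p.support_takeUntil_subset_support hx hz)⟩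

end JoinedWithin

open Classical in
/-- A graph of treewidth at most `t` has a balanced separator of size at most `t + 1` for
each vertex set `A`. -/
theorem HasTreewidthLE.exists_balanced_separator [Fintype V] {G : SimpleGraph V} {t : ℕ}
    (hG : HasTreewidthLE G t) (A : Finset V) :
    ∃ S : Finset V, S.card ≤ t + 1 ∧
      ∀ u ∈ A, u ∉ S → 2 * {v | JoinedWithin G {z | z ∈ A ∧ z ∉ S} u v}.toFinset.card ≤ A.card := by
  obtain ⟨ι, T, bag, ⟨hT, hcov, hedge, hsub⟩, hcard⟩ := hG
  obtain ⟨r⟩ := hT.connected.nonempty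
  rcases A.eq_empty_or_nonempty with rfl | hA
  · exact ⟨∅, by simp, by simp⟩
  -- the vertices of `A` living entirely below `i`
  let W : ι → Finset V := fun i => {v ∈ A | ∀ k, v ∈ bag k → k ∈ nodesBelow T r i}
  choose q hq using fun k => (hT.existsUnique_path r k).exists
  choose node hnode using hcov
  let I : Set ι := {i | A.card < 2 * (W i).card}
  have hIfin : I.Finite := by
    refine Set.Finite.subset (Set.finite_iUnion fun v : V =>
      List.finite_toSet (q (node v)).support) ?_
    intro i hi
    have : (W i).Nonempty := by
      rw [← Finset.card_pos]
      have : A.card < 2 * (W i).card := hi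
      omega
    obtain ⟨v, hv⟩ := this
    exact Set.mem_iUnion.2 ⟨v, (Finset.mem_filter.1 hv).2 _ (hnode v) _⟩
  have hrI : r ∈ I := by
    have : W r = A := by
      apply Finset.filter_true_of_mem
      intro v _ k _ p
      exact p.start_mem_support
    change A.card < 2 * (W r).card
    rw [this]
    have := hA.card_pos
    omega
  obtain ⟨i, hiI, hmax⟩ := hIfin.exists_maximalFor (fun i => (q i).length) I ⟨r, hrI⟩
  refine ⟨bag i, hcard i, fun u huA hui => ?_⟩
  set B : Set V := {z | z ∈ A ∧ z ∉ bag i} with hB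
  set D := {v | JoinedWithin G B u v}.toFinset with hD
  have hDmem : ∀ v, v ∈ D ↔ JoinedWithin G B u v := by simp [hD]
  by_cases hDW : ∃ v ∈ D, v ∈ W i
  · obtain ⟨v, hvD, hvW⟩ := hDW
    rw [hDmem] at hvD
    have hvi : v ∉ bag i := hvD.right_mem.2
    have hk := (Finset.mem_filter.1 hvW).2 _ (hnode v)
    have hki : node v ≠ i := fun h => hvi (h ▸ hnode v)
    have his := hk (q (node v))
    obtain ⟨j, hij, p, hpj, hjb, hlen⟩ : ∃ j, T.Adj i j ∧ ∃ p : T.Walk r i, j ∉ p.support ∧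
        node v ∈ nodesBelow T r j ∧ (q i).length < (q j).length := by
      have hdrop := (q (node v)).take_spec his
      have hp0 := hq (node v)
      generalize hp1 : (q (node v)).takeUntil i his = p at hdrop
      generalize (q (node v)).dropUntil i his = p' at hdrop
      cases p' with
      | nil => exact absurd rfl hki
      | @cons _ j _ h p'' =>
        rw [← hdrop] at hp0
        have hp0' : ((p.concat h).append p'').IsPath := by
          rwa [SimpleGraph.Walk.concat_append]
        have hpc : (p.concat h).IsPath := hp0'.of_append_left
        have hpp : p.IsPath := hp0.of_append_left
        have e1 : q i = p := congrArg Subtype.val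
          ((hT.isAcyclic.subsingleton_path _ _).elim ⟨_, hq i⟩ ⟨_, hpp⟩)
        have e2 : q j = p.concat h := congrArg Subtype.val
          ((hT.isAcyclic.subsingleton_path _ _).elim ⟨_, hq j⟩ ⟨_, hpc⟩)
        refine ⟨j, h, p, ((SimpleGraph.Walk.concat_isPath_iff h).1 hpc).2, ?_, ?_⟩
        · refine mem_nodesBelow_of_isPath hT.isAcyclic hp0' ?_
          rw [SimpleGraph.Walk.mem_support_append_iff]
          exact Or.inr p''.start_mem_support
        · rw [e1, e2, SimpleGraph.Walk.length_concat]
          omega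
    have hspread : ∀ x, x ∉ bag i → ∀ k, x ∈ bag k → k ∈ nodesBelow T r j →
        ∀ k', x ∈ bag k' → k' ∈ nodesBelow T r j := by
      intro x hx k hxk hk k' hxk'
      obtain ⟨s, hs⟩ := hsub x k k' hxk hxk'
      exact mem_nodesBelow_of_walk_avoiding hT.isAcyclic hij p hpj hk s fun h => hx (hs _ h)
    have hall : ∀ a b (s : G.Walk a b), (∀ z ∈ s.support, z ∈ B) →
        (∀ k, a ∈ bag k → k ∈ nodesBelow T r j) → ∀ k, b ∈ bag k → k ∈ nodesBelow T r j := by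
      intro a b s
      induction s with
      | nil => exact fun _ h => h
      | @cons a c b h s ih =>
        intro hs ha
        rw [SimpleGraph.Walk.support_cons] at hs
        refine ih (fun z hz => hs z (List.mem_cons_of_mem _ hz)) ?_
        obtain ⟨k, hak, hck⟩ := hedge _ _ h
        exact hspread c (hs c (List.mem_cons_of_mem _ s.start_mem_support)).2 k hck (ha k hak)
    have hDj : D ⊆ W j := by
      intro x hx
      rw [hDmem] at hx
      obtain ⟨s, hs⟩ := hvD.symm.trans hx
      exact Finset.mem_filter.2 ⟨hx.right_mem.1,
        hall v x s hs (hspread v hvi _ (hnode v) hjb)⟩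
    have hjI : j ∉ I := fun hj => by
      have := hmax hj hlen.le
      simp only at this
      omega
    have : ¬ A.card < 2 * (W j).card := hjI
    have := Finset.card_le_card hDj
    omega
  · push Not at hDW
    have h1 : D ∪ W i ⊆ A := by
      apply Finset.union_subset
      · intro x hx
        exact ((hDmem x).1 hx).right_mem.1
      · exact Finset.filter_subset _ _
    have h2 : Disjoint D (W i) := Finset.disjoint_left.2 hDW
    have h3 := Finset.card_le_card h1
    rw [Finset.card_union_of_disjoint h2] at h3
    have : A.card < 2 * (W i).card := hiI
    omega

open Classical in
/-- An elimination ranking: every vertex is reached from few vertices through vertices of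
rank at least that of the starting vertex. -/
theorem HasTreewidthLE.exists_ranking [Fintype V] {G : SimpleGraph V} {t : ℕ}
    (hG : HasTreewidthLE G t) (A : Finset V) :
    ∃ rk : V → ℕ, ∀ x ∈ A,
      {c | JoinedWithin G {z | z ∈ A ∧ rk c ≤ rk z} c x}.toFinset.card ≤
        (t + 1) * (Nat.log 2 A.card + 1) := by
  induction hn : A.card using Nat.strong_induction_on generalizing A with
  | _ n ih =>
  subst hn
  rcases A.eq_empty_or_nonempty with rfl | hA
  · exact ⟨fun _ => 0, by simp⟩
  obtain ⟨S, hS, hsep⟩ := hG.exists_balanced_separator A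
  have ih' : ∀ B : Finset V, ∃ rk : V → ℕ, B.card < A.card → ∀ x ∈ B,
      {c | JoinedWithin G {z | z ∈ B ∧ rk c ≤ rk z} c x}.toFinset.card ≤
        (t + 1) * (Nat.log 2 B.card + 1) := by
    intro B
    by_cases hB : B.card < A.card
    · obtain ⟨rk, h⟩ := ih _ hB B rfl
      exact ⟨rk, fun _ => h⟩
    · exact ⟨fun _ => 0, fun h => absurd h hB⟩
  choose rk hrk using ih'
  let comp : V → Finset V := fun u => {v | JoinedWithin G {z | z ∈ A ∧ z ∉ S} u v}.toFinset
  have hcomp : ∀ u v, v ∈ comp u ↔ JoinedWithin G {z | z ∈ A ∧ z ∉ S} u v := by simp [comp]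
  let R : V → ℕ := fun v => if v ∈ S then 0 else rk (comp v) v + 1
  have hR0 : ∀ v ∈ S, R v = 0 := fun v hv => if_pos hv
  have hR1 : ∀ v, v ∉ S → R v = rk (comp v) v + 1 := fun v hv => if_neg hv
  refine ⟨R, fun x hx => ?_⟩
  by_cases hxS : x ∈ S
  · refine (Finset.card_le_card (t := S) ?_).trans (hS.trans (Nat.le_mul_of_pos_right _ (by omega)))
    intro c hc
    simp only [mem_toFinset, mem_ofPred_eq] at hc
    have := hc.right_mem.2
    rw [hR0 x hxS] at this
    by_contra hcS
    rw [hR1 c hcS] at this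
    omega
  have hxx : x ∈ comp x := (hcomp x x).2 (JoinedWithin.refl ⟨hx, hxS⟩)
  have hhalf : 2 * (comp x).card ≤ A.card := hsep x hx hxS
  have hpos : 0 < (comp x).card := Finset.card_pos.2 ⟨x, hxx⟩
  have hlt : (comp x).card < A.card := by omega
  have key := hrk (comp x) hlt x hxx
  have hcover : {c | JoinedWithin G {z | z ∈ A ∧ R c ≤ R z} c x}.toFinset ⊆
      S ∪ {c | JoinedWithin G {z | z ∈ comp x ∧ rk (comp x) c ≤ rk (comp x) z} c x}.toFinset := by
    intro c hc
    simp only [mem_toFinset, mem_ofPred_eq, Finset.mem_union] at hc ⊢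
    by_cases hcS : c ∈ S
    · exact Or.inl hcS
    right
    obtain ⟨p, hp⟩ := hc
    have hin : ∀ z ∈ p.support, z ∈ {z | z ∈ A ∧ z ∉ S} := by
      intro z hz
      refine ⟨(hp z hz).1, fun hzS => ?_⟩
      have := (hp z hz).2
      rw [hR0 z hzS, hR1 c hcS] at this
      omega
    have heq : ∀ z ∈ p.support, comp z = comp x := by
      intro z hz
      have hcz := JoinedWithin.of_mem_support hin hz
      have hcx : JoinedWithin G {z | z ∈ A ∧ z ∉ S} c x := ⟨p, hin⟩
      ext y
      rw [hcomp, hcomp]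
      exact ⟨fun h => (hcx.symm.trans hcz).trans h, fun h => (hcz.symm.trans hcx).trans h⟩
    refine ⟨p, fun z hz => ⟨?_, ?_⟩⟩
    · rw [← heq z hz, hcomp]
      exact JoinedWithin.refl (hin z hz)
    · have := (hp z hz).2
      rw [hR1 c hcS, hR1 z (hin z hz).2, heq z hz, heq c p.start_mem_support] at this
      omega
  have hlog : Nat.log 2 (comp x).card + 1 ≤ Nat.log 2 A.card := by
    rw [← Nat.log_mul_base (by norm_num) hpos.ne']
    exact Nat.log_mono_right (by omega)
  calc _ ≤ _ := Finset.card_le_card hcover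
    _ ≤ _ := Finset.card_union_le _ _
    _ ≤ (t + 1) + (t + 1) * (Nat.log 2 (comp x).card + 1) := add_le_add hS key
    _ ≤ (t + 1) + (t + 1) * Nat.log 2 A.card := by gcongr
    _ = _ := by ring

/-- The ranking can be taken injective. -/
theorem HasTreewidthLE.exists_injective_ranking [Fintype V] {G : SimpleGraph V} {t : ℕ}
    (hG : HasTreewidthLE G t) :
    ∃ rk : V → ℕ, Function.Injective rk ∧ ∀ x,
      {c | JoinedWithin G {z | rk c ≤ rk z} c x}.ncard ≤
        (t + 1) * (Nat.log 2 (Fintype.card V) + 1) := by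
  classical
  obtain ⟨rk, hrk⟩ := hG.exists_ranking Finset.univ
  let e := Fintype.equivFin V
  have hlex : ∀ a b, rk a * Fintype.card V + e a ≤ rk b * Fintype.card V + e b → rk a ≤ rk b := by
    intro a b h
    by_contra! hlt
    have h1 : (rk b + 1) * Fintype.card V ≤ rk a * Fintype.card V :=
      Nat.mul_le_mul_right _ hlt
    have := (e b).2
    nlinarith
  refine ⟨fun v => rk v * Fintype.card V + e v, fun a b h => ?_, fun x => ?_⟩
  · simp only at h
    have h1 := (hlex a b h.le).antisymm (hlex b a h.ge)
    rw [h1] at h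
    exact e.injective (Fin.ext (by omega))
  · have := hrk x (Finset.mem_univ x)
    rw [Finset.card_univ] at this
    refine le_trans ?_ this
    rw [Set.ncard_eq_toFinset_card']
    refine Finset.card_le_card fun c hc => ?_
    simp only [mem_toFinset, mem_ofPred_eq] at hc ⊢
    exact hc.mono fun z hz => ⟨Finset.mem_univ z, hlex _ _ hz⟩

end Separator

section RandomSets

open Classical in
lemma card_forall_ne {V β : Type*} [Fintype V] [Fintype β] [Nonempty β] (X : Finset V) (b : β) :
    ((Finset.univ.filter fun ω : V → β => ∀ v ∈ X, ω v ≠ b).card : ℝ) =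
      Fintype.card (V → β) * (1 - 1 / Fintype.card β) ^ X.card := by
  have hβ : (0 : ℝ) < Fintype.card β := by exact_mod_cast Fintype.card_pos
  have h1 : (Finset.univ.filter fun ω : V → β => ∀ v ∈ X, ω v ≠ b) =
      Fintype.piFinset fun v => if v ∈ X then Finset.univ.erase b else Finset.univ := by
    ext ω
    simp only [Finset.mem_filter, Finset.mem_univ, true_and, Fintype.mem_piFinset]
    refine forall_congr' fun v => ?_
    by_cases hv : v ∈ X <;> simp [hv]
  have h2 : ∀ v, (((if v ∈ X then Finset.univ.erase b else Finset.univ : Finset β).card : ℕ) : ℝ) =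
      Fintype.card β * (if v ∈ X then 1 - 1 / (Fintype.card β : ℝ) else 1) := by
    intro v
    split_ifs
    · rw [Finset.card_erase_of_mem (Finset.mem_univ _), Finset.card_univ,
        Nat.cast_sub Fintype.card_pos]
      field_simp
      simp
    · simp
  rw [h1, Fintype.card_piFinset, Nat.cast_prod, Finset.prod_congr rfl fun v _ => h2 v,
    Finset.prod_mul_distrib, Finset.prod_ite_mem]
  simp

open Classical in
/-- A random set of density `1 / |β|` misses a set of size at most `|β|` and hits a disjoint set
of size at least `|β| / 2` with probability at least `1 / 16`. -/
lemma card_miss_and_hit {V β : Type*} [Fintype V] [Fintype β] (b : β) {N : ℕ} (hN : 1 ≤ N)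
    (hβ : Fintype.card β = 2 * N) {X Y : Finset V} (hXY : Disjoint X Y) (hX : X.card ≤ 2 * N)
    (hY : N ≤ Y.card) :
    (Fintype.card (V → β) : ℝ) ≤ 16 * (Finset.univ.filter fun ω : V → β =>
      (∀ v ∈ X, ω v ≠ b) ∧ ∃ v ∈ Y, ω v = b).card := by
  have : Nonempty β := ⟨b⟩
  have hsplit : ((Finset.univ.filter fun ω : V → β => ∀ v ∈ X, ω v ≠ b).card : ℝ) =
      (Finset.univ.filter fun ω : V → β => (∀ v ∈ X, ω v ≠ b) ∧ ∃ v ∈ Y, ω v = b).card +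
      (Finset.univ.filter fun ω : V → β => ∀ v ∈ X ∪ Y, ω v ≠ b).card := by
    rw [← Nat.cast_add, ← Finset.card_union_of_disjoint]
    · congr 2
      ext ω
      simp only [Finset.mem_filter, Finset.mem_univ, true_and, Finset.mem_union]
      grind
    · rw [Finset.disjoint_left]
      intro ω h1 h2
      simp only [Finset.mem_filter, Finset.mem_univ, true_and, Finset.mem_union] at h1 h2
      grind
  rw [card_forall_ne, card_forall_ne, Finset.card_union_of_disjoint hXY, hβ] at hsplit
  have hN' : (1 : ℝ) ≤ N := by exact_mod_cast hN
  push_cast at hsplit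
  set q : ℝ := 1 - 1 / (2 * N) with hq
  have hq0 : 0 < q := by
    rw [hq, sub_pos, div_lt_one (by linarith)]
    linarith
  have hq1 : q ≤ 1 := by
    rw [hq]
    have : 0 ≤ 1 / (2 * (N : ℝ)) := by positivity
    linarith
  have hlow : 1 / 2 ≤ q ^ N := by
    have := one_add_mul_le_pow (a := -(1 / (2 * (N : ℝ)))) (by linarith) N
    rw [← sub_eq_add_neg, ← hq] at this
    refine le_trans (le_of_eq ?_) this
    field_simp
    norm_num
  have hup : q ^ N ≤ 2 / 3 := by
    have h1 := one_add_mul_le_pow (a := 1 / (2 * (N : ℝ))) (by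
      have : 0 ≤ 1 / (2 * (N : ℝ)) := by positivity
      linarith) N
    have h2 : (1 : ℝ) + N * (1 / (2 * N)) = 3 / 2 := by field_simp; norm_num
    rw [h2] at h1
    have h3 : q ^ N * (1 + 1 / (2 * (N : ℝ))) ^ N ≤ 1 := by
      rw [← mul_pow]
      apply pow_le_one₀
      · positivity
      · rw [hq]
        have : 0 ≤ (1 / (2 * (N : ℝ))) ^ 2 := by positivity
        nlinarith
    have h4 : 0 < q ^ N := by positivity
    nlinarith
  have hX' : 1 / 4 ≤ q ^ X.card := by
    calc (1 : ℝ) / 4 = (1 / 2) ^ 2 := by norm_num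
      _ ≤ (q ^ N) ^ 2 := by gcongr
      _ = q ^ (2 * N) := by rw [← pow_mul, mul_comm]
      _ ≤ q ^ X.card := pow_le_pow_of_le_one hq0.le hq1 hX
  have hY' : q ^ Y.card ≤ 2 / 3 := (pow_le_pow_of_le_one hq0.le hq1 hY).trans hup
  have hM : (0 : ℝ) ≤ Fintype.card (V → β) := by positivity
  rw [pow_add] at hsplit
  have : (1 : ℝ) / 12 ≤ q ^ X.card * (1 - q ^ Y.card) := by nlinarith
  nlinarith

/-- The number of leading `true` bits of `b`. -/
def leadingTrues {m : ℕ} (b : Fin m → Bool) : ℕ :=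
  Nat.findGreatest (fun j => ∀ i : Fin m, i.1 < j → b i = true) m

lemma le_leadingTrues_iff {m : ℕ} (b : Fin m → Bool) (j : ℕ) :
    j ≤ leadingTrues b ↔ j ≤ m ∧ ∀ i : Fin m, i.1 < j → b i = true := by
  constructor
  · intro h
    have := Nat.findGreatest_spec (P := fun j => ∀ i : Fin m, i.1 < j → b i = true)
      (Nat.zero_le m) (by simp)
    exact ⟨h.trans (Nat.findGreatest_le m), fun i hi => this i (hi.trans_le h)⟩
  · rintro ⟨h1, h2⟩
    exact Nat.le_findGreatest h1 h2

lemma leadingTrues_le {m : ℕ} (b : Fin m → Bool) : leadingTrues b ≤ m :=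
  Nat.findGreatest_le m

open Classical in
lemma card_eq_const_mul {V β : Type*} [Fintype V] [Fintype β] (c : V) (b : β) :
    (Finset.univ.filter fun ω : V → β => ω c = b).card * Fintype.card β =
      Fintype.card (V → β) := by
  have : (Finset.univ.filter fun ω : V → β => ω c = b) =
      Fintype.piFinset fun v => if v = c then {b} else Finset.univ := by
    ext ω
    simp only [Finset.mem_filter, Finset.mem_univ, true_and, Fintype.mem_piFinset]
    constructor
    · intro h v
      by_cases hv : v = c
      · subst hv; simp [h]
      · simp [hv]
    · intro h
      simpa using h c
  rw [this, Fintype.card_piFinset, Fintype.card_fun, ← Finset.mul_prod_erase _ _ (Finset.mem_univ c),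
    Finset.prod_congr rfl (g := fun _ => Fintype.card β)]
  · have : 0 < Fintype.card V := Fintype.card_pos_iff.2 ⟨c⟩
    simp only [if_true, Finset.card_singleton, one_mul, Finset.prod_const,
      Finset.card_erase_of_mem (Finset.mem_univ c), Finset.card_univ]
    rw [← pow_succ, Nat.sub_add_cancel this]
  · intro v hv
    rw [if_neg (Finset.ne_of_mem_erase hv), Finset.card_univ]

open Classical in
/-- With geometric radii truncated at `m`, the first center of `N` to reach its threshold exceeds
it with probability at least `1 / 4`. -/
lemma card_first_exceeds {V : Type*} [Fintype V] {m : ℕ} (N : Finset V)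
    (hN : 2 * N.card ≤ 2 ^ m) (rk : V → ℕ) (hrk : Function.Injective rk) (h : V → ℕ)
    (hh : ∃ c ∈ N, h c = 0) :
    Fintype.card (V → Fin m → Bool) ≤ 4 * (Finset.univ.filter fun ω : V → Fin m → Bool =>
      ∃ c ∈ N, h c + 1 ≤ leadingTrues (ω c) ∧
        ∀ c' ∈ N, rk c' < rk c → leadingTrues (ω c') < h c').card := by
  set P : (V → Fin m → Bool) → V → Prop := fun ω c => c ∈ N ∧ h c ≤ leadingTrues (ω c) ∧
    ∀ c' ∈ N, rk c' < rk c → leadingTrues (ω c') < h c' with hP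
  have hex : ∀ ω, ∃ c, P ω c := by
    intro ω
    obtain ⟨c₀, hc₀, hc₀'⟩ := hh
    obtain ⟨c, hc, hmin⟩ := Finset.exists_min_image
      (N.filter fun c => h c ≤ leadingTrues (ω c)) rk ⟨c₀, by simp [hc₀, hc₀']⟩
    rw [Finset.mem_filter] at hc
    refine ⟨c, hc.1, hc.2, fun c' hc' hlt => ?_⟩
    by_contra! hle
    exact absurd (hmin c' (Finset.mem_filter.2 ⟨hc', hle⟩)) (not_le.2 hlt)
  have huniq : ∀ ω c c', P ω c → P ω c' → c = c' := by
    intro ω c c' ⟨h1, h2, h3⟩ ⟨h1', h2', h3'⟩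
    apply hrk
    rcases lt_trichotomy (rk c) (rk c') with hl | hl | hl
    · exact absurd h2 (not_le.2 (h3' c h1 hl))
    · exact hl
    · exact absurd h2' (not_le.2 (h3 c' h1' hl))
  choose F hF using hex
  set good := Finset.univ.filter fun ω : V → Fin m → Bool =>
      ∃ c ∈ N, h c + 1 ≤ leadingTrues (ω c) ∧
        ∀ c' ∈ N, rk c' < rk c → leadingTrues (ω c') < h c' with hgood
  set trunc := Finset.univ.filter fun ω : V → Fin m → Bool => ∃ c ∈ N, ω c = fun _ => true
    with htrunc
  set bad := Finset.univ \ (good ∪ trunc) with hbad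
  have hbit : ∀ ω ∈ bad, h (F ω) < m ∧ ∀ i : Fin m, i.1 = h (F ω) → ω (F ω) i = false := by
    intro ω hω
    simp only [hbad, hgood, htrunc, Finset.mem_sdiff, Finset.mem_univ, true_and, Finset.mem_union,
      Finset.mem_filter, not_or, not_exists, not_and] at hω
    obtain ⟨h1, h2, h3⟩ := hF ω
    have hlt : ¬ h (F ω) + 1 ≤ leadingTrues (ω (F ω)) := fun hle => hω.1 _ h1 hle h3
    have hlow := ((le_leadingTrues_iff _ _).1 h2)
    rw [le_leadingTrues_iff, not_and] at hlt
    have hm : h (F ω) < m := by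
      by_contra! hge
      refine hω.2 _ h1 (funext fun i => hlow.2 i (i.2.trans_le hge))
    have := hlt hm
    push Not at this
    obtain ⟨i, hi, hib⟩ := this
    have hi' : i.1 = h (F ω) := by
      by_contra hne
      exact hib (hlow.2 i (by omega))
    refine ⟨hm, fun i' hi'' => ?_⟩
    have : i' = i := Fin.ext (by omega)
    simpa [this] using hib
  set up : (V → Fin m → Bool) → Fin m → Bool := fun ω i =>
    if i.1 = h (F ω) then true else ω (F ω) i with hup
  have hinj : bad.card ≤ good.card := by
    have key : ∀ ω ∈ bad, h (F ω) + 1 ≤ leadingTrues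
        (up ω) := by
      intro ω hω
      have hlow := ((le_leadingTrues_iff _ _).1 (hF ω).2.1)
      rw [le_leadingTrues_iff]
      refine ⟨(hbit ω hω).1, fun i hi => ?_⟩
      by_cases hib : i.1 = h (F ω)
      · simp [hup, hib]
      · simp only [hup, if_neg hib]
        exact hlow.2 i (by omega)
    have keyP : ∀ ω ∈ bad, ∀ c' ∈ N, rk c' < rk (F ω) → leadingTrues
        (Function.update ω (F ω) (up ω) c') < h c' := by
      intro ω _ c' hc' hlt
      rw [Function.update_of_ne (by rintro rfl; exact lt_irrefl _ hlt)]
      exact (hF ω).2.2 c' hc' hlt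
    refine Finset.card_le_card_of_injOn
      (fun ω => Function.update ω (F ω) (up ω)) ?_ ?_
    · intro ω hω
      simp only [hgood, Finset.coe_filter, Finset.mem_univ, true_and, mem_ofPred_eq]
      refine ⟨F ω, (hF ω).1, ?_, keyP ω hω⟩
      rw [Function.update_self]
      exact key ω hω
    · intro ω hω ω' hω' heq
      simp only at heq
      have hPω : ∀ ω ∈ bad,
          P (Function.update ω (F ω) (up ω)) (F ω) := by
        intro ω hω
        refine ⟨(hF ω).1, ?_, keyP ω hω⟩
        rw [Function.update_self]
        exact (Nat.le_succ _).trans (key ω hω)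
      have hFF : F ω = F ω' := by
        refine huniq _ _ _ (hPω ω hω) ?_
        rw [heq]
        exact hPω ω' hω'
      funext v
      by_cases hv : v = F ω
      · subst hv
        have := congrFun heq (F ω)
        rw [Function.update_self, hFF, Function.update_self] at this
        funext i
        by_cases hi : i.1 = h (F ω)
        · rw [(hbit ω hω).2 i hi, hFF, (hbit ω' hω').2 i (hFF ▸ hi)]
        · have := congrFun this i
          simp only [hup, if_neg hi, if_neg (hFF ▸ hi : ¬ i.1 = h (F ω'))] at this
          rw [this, hFF]
      · have := congrFun heq v
        rwa [Function.update_of_ne hv, Function.update_of_ne (hFF ▸ hv)] at this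
  have htr : 2 * trunc.card ≤ Fintype.card (V → Fin m → Bool) := by
    have h1 : trunc ⊆ N.biUnion fun c =>
        Finset.univ.filter fun ω : V → Fin m → Bool => ω c = fun _ => true := by
      intro ω hω
      simpa [htrunc] using hω
    have h2 := (Finset.card_le_card h1).trans Finset.card_biUnion_le
    have h3 : trunc.card * 2 ^ m ≤ N.card * Fintype.card (V → Fin m → Bool) := by
      calc trunc.card * 2 ^ m ≤ _ := Nat.mul_le_mul_right _ h2
        _ = ∑ c ∈ N, Fintype.card (V → Fin m → Bool) := by
          rw [Finset.sum_mul]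
          refine Finset.sum_congr rfl fun c _ => ?_
          rw [← card_eq_const_mul c (fun _ : Fin m => true), Fintype.card_fun, Fintype.card_bool,
            Fintype.card_fin]
          congr!
        _ = _ := by simp
    have h4 : (2 * trunc.card) * 2 ^ m ≤ 2 ^ m * Fintype.card (V → Fin m → Bool) := by
      calc _ = 2 * (trunc.card * 2 ^ m) := by ring
        _ ≤ 2 * (N.card * Fintype.card (V → Fin m → Bool)) := by gcongr
        _ = (2 * N.card) * Fintype.card (V → Fin m → Bool) := by ring
        _ ≤ _ := by gcongr
    rw [mul_comm] at h4
    exact Nat.le_of_mul_le_mul_left h4 (by positivity)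
  have htot : Fintype.card (V → Fin m → Bool) ≤ bad.card + (good.card + trunc.card) := by
    calc Fintype.card (V → Fin m → Bool) = (Finset.univ : Finset (V → Fin m → Bool)).card := rfl
      _ ≤ bad.card + (good ∪ trunc).card := by
        rw [hbad]
        exact Nat.sub_le_iff_le_add.1 (Finset.le_card_sdiff _ _)
      _ ≤ _ := by gcongr; exact Finset.card_union_le _ _
  omega

open Classical in
lemma card_eq_true_and_eq_false {V : Type*} [Fintype V] {a b : V} (hab : a ≠ b) :
    Fintype.card (V → Bool) =
      4 * (Finset.univ.filter fun σ : V → Bool => σ a = true ∧ σ b = false).card := by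
  have : (Finset.univ.filter fun σ : V → Bool => σ a = true ∧ σ b = false) =
      Fintype.piFinset fun v => if v = a then {true} else if v = b then {false}
        else Finset.univ := by
    ext ω
    simp only [Finset.mem_filter, Finset.mem_univ, true_and, Fintype.mem_piFinset]
    constructor
    · intro h v
      by_cases hv : v = a
      · subst hv; simp [h.1]
      · by_cases hv' : v = b
        · subst hv'; simp [hv, h.2]
        · simp [hv, hv']
    · intro h
      have h1 := h a
      have h2 := h b
      simp only [if_true, if_neg hab.symm, Finset.mem_singleton] at h1 h2
      exact ⟨h1, h2⟩
  rw [this, Fintype.card_piFinset, Fintype.card_fun, ← Finset.mul_prod_erase _ _ (Finset.mem_univ a),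
    ← Finset.mul_prod_erase _ _ (Finset.mem_erase.2 ⟨hab.symm, Finset.mem_univ b⟩),
    Finset.prod_congr rfl (g := fun _ => 2)]
  · have h1 : ((Finset.univ.erase a).erase b).card + 2 = Fintype.card V := by
      rw [Finset.card_erase_of_mem (Finset.mem_erase.2 ⟨hab.symm, Finset.mem_univ b⟩),
        Finset.card_erase_of_mem (Finset.mem_univ a), Finset.card_univ]
      have : 1 < Fintype.card V := Fintype.one_lt_card_iff.2 ⟨a, b, hab⟩
      omega
    rw [← h1]
    simp [hab.symm]
    ring
  · intro v hv
    simp only [Finset.mem_erase, Finset.mem_univ, and_true] at hv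
    simp [hv.1, hv.2]

end RandomSets

section ShortestPathMetric

variable {V : Type*} {G : SimpleGraph V} {w : Sym2 V → ℝ}

lemma walkWeight_nonneg (hw : ∀ e, 0 ≤ w e) {u v : V} (p : G.Walk u v) : 0 ≤ walkWeight w p := by
  refine List.sum_nonneg fun r hr => ?_
  obtain ⟨e, -, rfl⟩ := List.mem_map.1 hr
  exact hw e

lemma walkWeight_append {u v x : V} (p : G.Walk u v) (q : G.Walk v x) :
    walkWeight w (p.append q) = walkWeight w p + walkWeight w q := by
  simp [walkWeight]

lemma walkWeight_reverse {u v : V} (p : G.Walk u v) :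
    walkWeight w p.reverse = walkWeight w p := by
  simp [walkWeight, List.sum_reverse]

lemma graphDist_le_walkWeight (hw : ∀ e, 0 ≤ w e) {u v : V} (p : G.Walk u v) :
    graphDist G w u v ≤ walkWeight w p :=
  csInf_le ⟨0, by rintro r ⟨q, rfl⟩; exact walkWeight_nonneg hw q⟩ ⟨p, rfl⟩

lemma exists_walkWeight_lt (hG : G.Connected) {u v : V} {r : ℝ} (h : graphDist G w u v < r) :
    ∃ p : G.Walk u v, walkWeight w p < r := by
  obtain ⟨p⟩ := hG.preconnected u v
  obtain ⟨_, ⟨q, rfl⟩, hq⟩ :=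
    exists_lt_of_csInf_lt (s := {r | ∃ p : G.Walk u v, r = walkWeight w p}) ⟨_, p, rfl⟩ h
  exact ⟨q, hq⟩

lemma graphDist_nonneg (hw : ∀ e, 0 ≤ w e) (u v : V) : 0 ≤ graphDist G w u v :=
  Real.sInf_nonneg (by rintro r ⟨q, rfl⟩; exact walkWeight_nonneg hw q)

lemma graphDist_self (hw : ∀ e, 0 ≤ w e) (u : V) : graphDist G w u u = 0 :=
  le_antisymm (by simpa [walkWeight] using graphDist_le_walkWeight hw (.nil : G.Walk u u))
    (graphDist_nonneg hw u u)

lemma graphDist_comm (u v : V) : graphDist G w u v = graphDist G w v u := by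
  unfold graphDist
  congr 1
  ext r
  exact ⟨fun ⟨p, hp⟩ => ⟨p.reverse, by rw [hp, walkWeight_reverse]⟩,
    fun ⟨p, hp⟩ => ⟨p.reverse, by rw [hp, walkWeight_reverse]⟩⟩

lemma graphDist_triangle (hw : ∀ e, 0 ≤ w e) (hG : G.Connected) (u v x : V) :
    graphDist G w u x ≤ graphDist G w u v + graphDist G w v x := by
  refine le_of_forall_pos_lt_add fun ε hε => ?_
  obtain ⟨p, hp⟩ := exists_walkWeight_lt (w := w) hG
    (lt_add_of_pos_right (graphDist G w u v) (half_pos hε))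
  obtain ⟨q, hq⟩ := exists_walkWeight_lt (w := w) hG
    (lt_add_of_pos_right (graphDist G w v x) (half_pos hε))
  have := graphDist_le_walkWeight hw (p.append q)
  rw [walkWeight_append] at this
  linarith

/-- The shortest-path metric as a pseudometric space structure. -/
noncomputable abbrev graphPseudoMetricSpace (hw : ∀ e, 0 ≤ w e) (hG : G.Connected) :
    PseudoMetricSpace V where
  dist := graphDist G w
  dist_self := graphDist_self hw
  dist_comm := graphDist_comm
  dist_triangle := graphDist_triangle hw hG

end ShortestPathMetric

open Classical in
/-- At every scale `Δ` there is a random set `Z` which, for all `x` and `y` at distance at least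
`Δ`, contains `y` and stays at distance `Δ / (4 α)` from `x` with probability at least `1 / 16`. -/
def HasPaddedCuts {V : Type} (d : V → V → ℝ) (α : ℕ) : Prop :=
  ∀ Δ : ℝ, 0 < Δ → ∃ (Ω : Type) (_ : Fintype Ω) (_ : Nonempty Ω) (Z : Ω → Set V),
    ∀ x y, Δ ≤ d x y → Fintype.card Ω ≤
      16 * (Finset.univ.filter fun ω => y ∈ Z ω ∧ ∀ z ∈ Z ω, Δ / (4 * α) ≤ d x z).card

open Classical in
/-- Carving balls of truncated geometric radii around the vertices, in the order of a ranking in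
which every vertex is reached from at most `2 ^ m / 2` vertices, yields padded cuts. -/
theorem hasPaddedCuts_of_ranking {V : Type} [Fintype V] {G : SimpleGraph V} {w : Sym2 V → ℝ}
    (hw : ∀ e, 0 ≤ w e) (hG : G.Connected) {rk : V → ℕ} (hrk : Function.Injective rk) {m : ℕ}
    (hm : ∀ x, 2 * {c | JoinedWithin G {z | rk c ≤ rk z} c x}.ncard ≤ 2 ^ m) :
    HasPaddedCuts (graphDist G w) (m + 1) := by
  intro Δ hΔ
  set γ : ℝ := Δ / (4 * ((m + 1 : ℕ) : ℝ)) with hγ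
  have hγ0 : 0 < γ := by positivity
  have hΔγ : Δ = 4 * γ * (m + 1) := by
    rw [hγ]
    push_cast
    field_simp
  let R : (V → Fin m → Bool) → V → ℝ := fun ω c => 2 * γ * (1 + leadingTrues (ω c))
  have hR0 : ∀ ω c, 0 < R ω c := fun ω c => by positivity
  have hRle : ∀ ω c, R ω c ≤ 2 * γ * (m + 1) := by
    intro ω c
    have : (leadingTrues (ω c) : ℝ) ≤ m := by exact_mod_cast leadingTrues_le (ω c)
    simp only [R]
    nlinarith
  let Cap : (V → Fin m → Bool) → V → V → Prop := fun ω c z =>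
    ∃ p : G.Walk c z, (∀ v ∈ p.support, rk c ≤ rk v) ∧ walkWeight w p < R ω c
  have hctr : ∀ ω z, ∃ c, Cap ω c z ∧ ∀ c', Cap ω c' z → rk c ≤ rk c' := by
    intro ω z
    obtain ⟨c, hc, hmin⟩ := Finset.exists_min_image (Finset.univ.filter fun c => Cap ω c z) rk
      ⟨z, by
        rw [Finset.mem_filter]
        exact ⟨Finset.mem_univ z, .nil, by simp, by simpa [walkWeight] using hR0 ω z⟩⟩
    refine ⟨c, (Finset.mem_filter.1 hc).2, fun c' hc' => ?_⟩
    exact hmin c' (Finset.mem_filter.2 ⟨Finset.mem_univ c', hc'⟩)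
  choose ctr hctr1 hctr2 using hctr
  refine ⟨(V → Fin m → Bool) × (V → Bool), inferInstance, inferInstance,
    fun ω => {z | ω.2 (ctr ω.1 z) = false}, fun x y hxy => ?_⟩
  have hne : ∀ ω, ctr ω x ≠ ctr ω y := by
    intro ω h
    obtain ⟨p, -, hp⟩ := hctr1 ω x
    obtain ⟨q, -, hq⟩ := hctr1 ω y
    have h1 := graphDist_le_walkWeight hw p
    have h2 := graphDist_le_walkWeight hw q
    have h4 := hRle ω (ctr ω y)
    have h3 := graphDist_triangle hw hG x (ctr ω x) y
    rw [graphDist_comm x (ctr ω x)] at h3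
    have h5 : graphDist G w (ctr ω x) y = graphDist G w (ctr ω y) y := by rw [h]
    have := hRle ω (ctr ω x)
    linarith
  -- the restricted distances to `x`
  let wts : V → Set ℝ := fun c =>
    {r | ∃ p : G.Walk c x, (∀ v ∈ p.support, rk c ≤ rk v) ∧ r = walkWeight w p}
  have hbdd : ∀ c, BddBelow (wts c) := fun c =>
    ⟨0, by rintro r ⟨p, -, rfl⟩; exact walkWeight_nonneg hw p⟩
  let D : V → ℝ := fun c => sInf (wts c)
  let N : Finset V := {c | JoinedWithin G {z | rk c ≤ rk z} c x}.toFinset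
  have hN : ∀ c, c ∈ N ↔ (wts c).Nonempty := by
    intro c
    simp only [N, mem_toFinset, mem_ofPred_eq]
    exact ⟨fun ⟨p, hp⟩ => ⟨_, p, hp, rfl⟩, fun ⟨_, p, hp, _⟩ => ⟨p, hp⟩⟩
  have hDle : ∀ c (p : G.Walk c x), (∀ v ∈ p.support, rk c ≤ rk v) → D c ≤ walkWeight w p :=
    fun c p hp => csInf_le (hbdd c) ⟨p, hp, rfl⟩
  let h : V → ℕ := fun c => ⌈(D c / γ - 3) / 2⌉₊
  have hfar : ∀ c ω, leadingTrues (ω c) < h c → R ω c < D c - γ := by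
    intro c ω hlt
    have := Nat.lt_ceil.1 hlt
    have h2 : D c / γ * γ = D c := by field_simp
    simp only [R]
    nlinarith
  have hnear : ∀ c ω, h c + 1 ≤ leadingTrues (ω c) → D c + γ ≤ R ω c := by
    intro c ω hle
    have h1 := Nat.le_ceil ((D c / γ - 3) / 2)
    have h2 : D c / γ * γ = D c := by field_simp
    have h3 : ((h c : ℝ) + 1) ≤ leadingTrues (ω c) := by exact_mod_cast hle
    simp only [R]
    have h4 : (D c / γ - 3) / 2 ≤ h c := h1
    nlinarith
  have hgood := card_first_exceeds (m := m) N (by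
    have := hm x
    rwa [Set.ncard_eq_toFinset_card'] at this) rk hrk h ⟨x, (hN x).2 ⟨_, .nil, by simp, rfl⟩, by
      have : D x ≤ 0 := by simpa [walkWeight] using hDle x .nil (by simp)
      have h2 : D x / γ ≤ 0 := div_nonpos_of_nonpos_of_nonneg this hγ0.le
      exact Nat.ceil_eq_zero.2 (by linarith)⟩
  set good := Finset.univ.filter fun ω : V → Fin m → Bool =>
      ∃ c ∈ N, h c + 1 ≤ leadingTrues (ω c) ∧
        ∀ c' ∈ N, rk c' < rk c → leadingTrues (ω c') < h c' with hgooddef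
  have hpad : ∀ ω ∈ good, ∀ z, graphDist G w x z < γ → ctr ω z = ctr ω x := by
    intro ω hω
    obtain ⟨-, c, hcN, hcle, hcfirst⟩ := Finset.mem_filter.1 hω
    have hclose : ∀ c', D c' - γ < R ω c' → c' ∈ N → rk c ≤ rk c' := by
      intro c' hlt hc'
      by_contra! hrk'
      exact absurd (hfar c' ω (hcfirst c' hc' hrk')) (not_lt.2 hlt.le)
    suffices hall : ∀ z, graphDist G w x z < γ → ctr ω z = c by
      intro z hz
      rw [hall z hz, hall x (by rwa [graphDist_self hw])]
    intro z hz
    obtain ⟨p, hp⟩ := exists_walkWeight_lt hG hz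
    have hprk : ∀ v ∈ p.support, rk c ≤ rk v := by
      obtain ⟨v₀, hv₀, hmin⟩ := Finset.exists_min_image p.support.toFinset rk
        ⟨x, by simp⟩
      rw [List.mem_toFinset] at hv₀
      intro v hv
      refine le_trans (hclose v₀ ?_ ?_) (hmin v (List.mem_toFinset.2 hv))
      all_goals
        have hsup : ∀ u ∈ (p.takeUntil v₀ hv₀).reverse.support, rk v₀ ≤ rk u := by
          intro u hu
          rw [SimpleGraph.Walk.support_reverse, List.mem_reverse] at hu
          exact hmin u (List.mem_toFinset.2 (p.support_takeUntil_subset_support hv₀ hu))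
      · have h1 := hDle v₀ _ hsup
        have h2 : walkWeight w (p.takeUntil v₀ hv₀) ≤ walkWeight w p := by
          conv_rhs => rw [← p.take_spec hv₀, walkWeight_append]
          have := walkWeight_nonneg hw (p.dropUntil v₀ hv₀)
          linarith
        rw [walkWeight_reverse] at h1
        have := hR0 ω v₀
        linarith
      · exact (hN v₀).2 ⟨_, _, hsup, rfl⟩
    have hcap : Cap ω c z := by
      have hlt : D c < R ω c - walkWeight w p := by
        have := hnear c ω hcle
        linarith
      obtain ⟨_, ⟨q, hq, rfl⟩, hqlt⟩ := exists_lt_of_csInf_lt ((hN c).1 hcN) hlt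
      refine ⟨q.append p, fun v hv => ?_, by rw [walkWeight_append]; linarith⟩
      rcases (SimpleGraph.Walk.mem_support_append_iff _ _).1 hv with h | h
      exacts [hq v h, hprk v h]
    refine hrk (le_antisymm (hctr2 ω z c hcap) ?_)
    obtain ⟨q, hq, hqR⟩ := hctr1 ω z
    by_contra! hlt
    have hsup : ∀ v ∈ (q.append p.reverse).support, rk (ctr ω z) ≤ rk v := by
      intro v hv
      rcases (SimpleGraph.Walk.mem_support_append_iff _ _).1 hv with h | h
      · exact hq v h
      · rw [SimpleGraph.Walk.support_reverse, List.mem_reverse] at h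
        exact hlt.le.trans (hprk v h)
    have h1 := hDle _ _ hsup
    rw [walkWeight_append, walkWeight_reverse] at h1
    exact absurd (hclose (ctr ω z) (by linarith) ((hN _).2 ⟨_, _, hsup, rfl⟩)) (not_le.2 hlt)
  set event := Finset.univ.filter fun ω : (V → Fin m → Bool) × (V → Bool) =>
    y ∈ {z | ω.2 (ctr ω.1 z) = false} ∧
      ∀ z ∈ {z | ω.2 (ctr ω.1 z) = false}, γ ≤ graphDist G w x z with hevent
  have hsub : (good.sigma fun ω => Finset.univ.filter fun σ : V → Bool =>
      σ (ctr ω x) = true ∧ σ (ctr ω y) = false).card ≤ event.card := by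
    refine Finset.card_le_card_of_injOn (fun s => (s.1, s.2)) ?_ ?_
    · rintro ⟨ω, σ⟩ hs
      simp only [Finset.coe_sigma, mem_sigma_iff, Finset.mem_coe, Finset.mem_filter,
        Finset.mem_univ, true_and] at hs
      simp only [hevent, Finset.coe_filter, Finset.mem_univ, true_and, mem_ofPred_eq]
      refine ⟨hs.2.2, fun z hz => ?_⟩
      by_contra! hlt
      rw [hpad ω hs.1 z hlt, hs.2.1] at hz
      simp at hz
    · rintro ⟨ω, σ⟩ - ⟨ω', σ'⟩ - heq
      simp only [Prod.mk.injEq] at heq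
      obtain ⟨rfl, rfl⟩ := heq
      rfl
  rw [Finset.card_sigma] at hsub
  have hsum : 4 * ∑ ω ∈ good, (Finset.univ.filter fun σ : V → Bool =>
      σ (ctr ω x) = true ∧ σ (ctr ω y) = false).card = good.card * Fintype.card (V → Bool) := by
    rw [Finset.mul_sum, Finset.sum_congr rfl fun ω _ => (card_eq_true_and_eq_false (hne ω)).symm]
    simp
  have hfinal : Fintype.card ((V → Fin m → Bool) × (V → Bool)) ≤ 16 * event.card := calc
    Fintype.card ((V → Fin m → Bool) × (V → Bool))
      = Fintype.card (V → Fin m → Bool) * Fintype.card (V → Bool) := Fintype.card_prod _ _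
    _ ≤ 4 * good.card * Fintype.card (V → Bool) := Nat.mul_le_mul_right _ hgood
    _ ≤ 16 * event.card := by rw [mul_assoc, ← hsum]; omega
  convert hfinal

section HilbertSq

/-- `E` is the square of a Hilbertian pseudometric. -/
def IsHilbertSq {V : Type} (E : V → V → ℝ) : Prop :=
  ∃ (J : Type) (_ : Fintype J) (F : J → V → ℝ), ∀ x y, E x y = ∑ j, (F j x - F j y) ^ 2

variable {V : Type}

lemma IsHilbertSq.symm {E : V → V → ℝ} (hE : IsHilbertSq E) (x y : V) : E x y = E y x := by
  obtain ⟨J, _, F, hF⟩ := hE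
  rw [hF, hF]
  exact Finset.sum_congr rfl fun j _ => by ring

lemma IsHilbertSq.nonneg {E : V → V → ℝ} (hE : IsHilbertSq E) (x y : V) : 0 ≤ E x y := by
  obtain ⟨J, _, F, hF⟩ := hE
  rw [hF]
  positivity

lemma IsHilbertSq.sum {ι : Type} (s : Finset ι) {E : ι → V → V → ℝ}
    (hE : ∀ i ∈ s, IsHilbertSq (E i)) : IsHilbertSq fun x y => ∑ i ∈ s, E i x y := by
  have hE' : ∀ i : s, IsHilbertSq (E i) := fun i => hE i i.2
  choose J hJ F hF using hE'
  refine ⟨Σ i, J i, inferInstance, fun j => F j.1 j.2, fun x y => ?_⟩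
  rw [Fintype.sum_sigma]
  refine (Finset.sum_coe_sort s fun i => E i x y).symm.trans ?_
  exact Finset.sum_congr rfl fun i _ => hF i x y

lemma IsHilbertSq.add {E E' : V → V → ℝ} (hE : IsHilbertSq E) (hE' : IsHilbertSq E') :
    IsHilbertSq fun x y => E x y + E' x y := by
  obtain ⟨J, _, F, hF⟩ := hE
  obtain ⟨J', _, F', hF'⟩ := hE'
  exact ⟨J ⊕ J', inferInstance, Sum.elim F F', fun x y => by simp [hF, hF']⟩

lemma IsHilbertSq.exists_map {E : V → V → ℝ} (hE : IsHilbertSq E) :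
    ∃ (J : Type) (_ : Fintype J) (f : V → EuclideanSpace ℝ J),
      ∀ x y, ‖f x - f y‖ = Real.sqrt (E x y) := by
  obtain ⟨J, _, F, hF⟩ := hE
  refine ⟨J, inferInstance, fun x => WithLp.toLp 2 fun j => F j x, fun x y => ?_⟩
  rw [EuclideanSpace.norm_eq, hF]
  simp

/-- The mean square of the increments of a finite family of functions. -/
noncomputable def meanSq {Ω : Type} [Fintype Ω] (F : Ω → V → ℝ) (x y : V) : ℝ :=
  (∑ ω, (F ω x - F ω y) ^ 2) / Fintype.card Ω

variable {Ω : Type} [Fintype Ω] {F : Ω → V → ℝ}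

lemma isHilbertSq_meanSq (F : Ω → V → ℝ) : IsHilbertSq (meanSq F) := by
  refine ⟨Ω, inferInstance, fun ω x => F ω x / Real.sqrt (Fintype.card Ω), fun x y => ?_⟩
  rw [meanSq, Finset.sum_div]
  refine Finset.sum_congr rfl fun ω _ => ?_
  rw [← sub_div, div_pow, Real.sq_sqrt (Nat.cast_nonneg _)]

lemma meanSq_le {x y : V} {a : ℝ} (h : ∀ ω, |F ω x - F ω y| ≤ a) : meanSq F x y ≤ a ^ 2 := by
  refine div_le_of_le_mul₀ (Nat.cast_nonneg _) (sq_nonneg a) ?_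
  calc ∑ ω, (F ω x - F ω y) ^ 2 ≤ ∑ _ω : Ω, a ^ 2 :=
        Finset.sum_le_sum fun ω _ => sq_le_sq.2 ((h ω).trans (le_abs_self a))
    _ = a ^ 2 * Fintype.card Ω := by simp [mul_comm]

lemma le_meanSq [Nonempty Ω] {x y : V} {a : ℝ} (ha : 0 ≤ a) {s : Finset Ω}
    (hs : (Fintype.card Ω : ℝ) ≤ 16 * s.card) (h : ∀ ω ∈ s, a ≤ |F ω x - F ω y|) :
    a ^ 2 / 16 ≤ meanSq F x y := by
  have hΩ : (0 : ℝ) < Fintype.card Ω := by exact_mod_cast Fintype.card_pos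
  rw [meanSq, le_div_iff₀ hΩ]
  calc a ^ 2 / 16 * Fintype.card Ω ≤ s.card * a ^ 2 := by nlinarith [sq_nonneg a]
    _ = ∑ ω ∈ s, a ^ 2 := by simp
    _ ≤ ∑ ω ∈ s, (F ω x - F ω y) ^ 2 :=
        Finset.sum_le_sum fun ω hω => sq_le_sq.2 (by rw [abs_of_nonneg ha]; exact h ω hω)
    _ ≤ ∑ ω, (F ω x - F ω y) ^ 2 :=
        Finset.sum_le_sum_of_subset_of_nonneg (Finset.subset_univ s) fun _ _ _ => sq_nonneg _

end HilbertSq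

section MeasuredDescent

open Metric

variable {V : Type} [PseudoMetricSpace V]

/-- The number of points in the closed ball of radius `r` around `x`. -/
noncomputable def ballCard (x : V) (r : ℝ) : ℕ := (closedBall x r).ncard

/-- The least radius at which the ball around `x` has at least `k` points. -/
noncomputable def critRadius (k : ℕ) (x : V) : ℝ := sInf {r | 0 ≤ r ∧ k ≤ ballCard x r}

lemma critRadius_bddBelow (k : ℕ) (x : V) : BddBelow {r | 0 ≤ r ∧ k ≤ ballCard x r} :=
  ⟨0, fun _ hr => hr.1⟩

lemma abs_infDist_sub_le (s : Set V) (x y : V) : |infDist x s - infDist y s| ≤ dist x y := by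
  have := (lipschitz_infDist_pt s).dist_le_mul x y
  simpa [Real.dist_eq] using this

variable [Fintype V]

lemma ballCard_mono (x : V) : Monotone (ballCard x) := fun _ _ h =>
  Set.ncard_le_ncard (closedBall_subset_closedBall h) (toFinite _)

lemma ballCard_le_of_dist (x y : V) (r : ℝ) : ballCard y r ≤ ballCard x (r + dist x y) :=
  Set.ncard_le_ncard (closedBall_subset_closedBall' (by rw [dist_comm])) (toFinite _)

lemma one_le_ballCard (x : V) {r : ℝ} (hr : 0 ≤ r) : 1 ≤ ballCard x r :=
  (Set.ncard_pos (toFinite _)).2 ⟨x, mem_closedBall_self hr⟩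

lemma ballCard_le_card (x : V) (r : ℝ) : ballCard x r ≤ Fintype.card V := by
  rw [← Nat.card_eq_fintype_card]
  exact Set.ncard_le_card _

lemma critRadius_le_add_dist (k : ℕ) (x y : V) :
    critRadius k x ≤ critRadius k y + dist x y := by
  have hshift : ∀ {x y : V} {r : ℝ}, 0 ≤ r ∧ k ≤ ballCard y r →
      0 ≤ r + dist x y ∧ k ≤ ballCard x (r + dist x y) := fun {x y r} hr =>
    ⟨by have := hr.1; positivity, hr.2.trans (ballCard_le_of_dist x y r)⟩
  rcases Set.eq_empty_or_nonempty {r | 0 ≤ r ∧ k ≤ ballCard y r} with hy | hy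
  · have hx : {r | 0 ≤ r ∧ k ≤ ballCard x r} = ∅ := by
      by_contra hx
      obtain ⟨r, hr⟩ := Set.nonempty_iff_ne_empty.2 hx
      exact hy.subset (hshift hr)
    simp [critRadius, hx, hy]
  · rw [← sub_le_iff_le_add]
    refine le_csInf hy fun r hr => ?_
    rw [sub_le_iff_le_add]
    exact csInf_le (critRadius_bddBelow k x) (hshift hr)

lemma abs_critRadius_sub_le (k : ℕ) (x y : V) :
    |critRadius k x - critRadius k y| ≤ dist x y := by
  have h1 := critRadius_le_add_dist k x y
  have h2 := critRadius_le_add_dist k y x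
  rw [dist_comm] at h2
  rw [abs_le]
  constructor <;> linarith

lemma critRadius_mem_Icc {k : ℕ} {x : V} {a b : ℝ} (hb : 0 ≤ b) (ha : ballCard x a < k)
    (hkb : k ≤ ballCard x b) : critRadius k x ∈ Icc a b := by
  refine ⟨le_csInf ⟨b, hb, hkb⟩ fun r hr => ?_, csInf_le (critRadius_bddBelow k x) ⟨hb, hkb⟩⟩
  by_contra! hlt
  exact absurd (hr.2.trans (ballCard_mono x hlt.le)) (not_le.2 ha)

variable (V) in
/-- Distances to random sets of density `2 ^ -(t + 1)` detect the growth of balls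
past `2 ^ t` points. -/
lemma exists_isHilbertSq_growth (t : ℕ) :
    ∃ E : V → V → ℝ, IsHilbertSq E ∧ (∀ x y, E x y ≤ dist x y ^ 2) ∧
      ∀ x y r s, s ≤ r → r + s < dist x y → 2 ^ t ≤ ballCard y s → ballCard x r < 2 ^ (t + 1) →
        (r - s) ^ 2 / 16 ≤ E x y := by
  classical
  let A : (V → Fin (t + 1) → Bool) → Set V := fun ω => {v | ω v = fun _ => true}
  let F : (V → Fin (t + 1) → Bool) → V → ℝ := fun ω v => infDist v (A ω)
  refine ⟨meanSq F, isHilbertSq_meanSq F,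
    fun x y => meanSq_le fun ω => abs_infDist_sub_le (A ω) x y, fun x y r s hsr hd hy hx => ?_⟩
  have hdisj : Disjoint (closedBall x r).toFinset (closedBall y s).toFinset := by
    rw [Set.disjoint_toFinset]
    exact closedBall_disjoint_closedBall hd
  refine le_meanSq (sub_nonneg.2 hsr) (card_miss_and_hit (fun _ : Fin (t + 1) => true)
    (N := 2 ^ t) Nat.one_le_two_pow (by simp [pow_succ']) hdisj ?_ ?_) fun ω hω => ?_
  · rw [← Set.ncard_eq_toFinset_card', ← pow_succ']
    exact hx.le
  · rwa [← Set.ncard_eq_toFinset_card']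
  · simp only [Finset.mem_filter, Finset.mem_univ, true_and, mem_toFinset] at hω
    obtain ⟨hmiss, v, hv, hvA⟩ := hω
    have h1 : infDist y (A ω) ≤ s :=
      (infDist_le_dist_of_mem (s := A ω) hvA).trans (by rw [dist_comm]; exact hv)
    have h2 : r ≤ infDist x (A ω) := by
      refine (le_infDist ⟨v, hvA⟩).2 fun {z} hz => ?_
      by_contra! hlt
      exact hmiss z (by rw [mem_closedBall, dist_comm]; exact hlt.le) hz
    exact le_trans (by linarith) (le_abs_self (F ω x - F ω y))

/-- Distances to padded cuts at scale `Δ`, restricted to the points where `ρ` is about `Δ`. -/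
lemma exists_isHilbertSq_scale {α : ℕ} (hα : 1 ≤ α)
    (hpad : HasPaddedCuts (dist : V → V → ℝ) α) {Δ : ℝ} (hΔ : 0 < Δ) {ρ : V → ℝ}
    (hρ : ∀ x y, |ρ x - ρ y| ≤ dist x y) :
    ∃ E : V → V → ℝ, IsHilbertSq E ∧ (∀ x y, E x y ≤ dist x y ^ 2) ∧
      (∀ x y, ρ x ∉ Ioo (Δ / 16) Δ → ρ y ∉ Ioo (Δ / 16) Δ → E x y = 0) ∧
      ∀ x y, Δ ≤ dist x y → ρ x ∈ Icc (Δ / 8) (Δ / 2) → (Δ / (16 * α)) ^ 2 / 16 ≤ E x y := by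
  classical
  obtain ⟨Ω, _, _, Z, hZ⟩ := hpad Δ hΔ
  let b : ℝ → ℝ := fun r => max 0 (min (r - Δ / 16) (Δ - r))
  have hb0 : ∀ r, 0 ≤ b r := fun r => le_max_left _ _
  have hbL : ∀ r r', |b r - b r'| ≤ |r - r'| := by
    intro r r'
    refine (abs_max_sub_max_le_max _ _ _ _).trans (max_le (by simp) ?_)
    refine (abs_min_sub_min_le_max _ _ _ _).trans (max_le (by simp) ?_)
    rw [sub_sub_sub_cancel_left, abs_sub_comm]
  have hbout : ∀ r, r ∉ Ioo (Δ / 16) Δ → b r = 0 := by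
    intro r hr
    refine max_eq_left ?_
    by_contra! h
    have := lt_min_iff.1 h
    exact hr ⟨by linarith, by linarith⟩
  let F : Ω → V → ℝ := fun ω z => min (infDist z (Z ω)) (b (ρ z))
  refine ⟨meanSq F, isHilbertSq_meanSq F, fun x y => meanSq_le fun ω => ?_, fun x y hx hy => ?_,
    fun x y hxy hx => ?_⟩
  · exact (abs_min_sub_min_le_max _ _ _ _).trans
      (max_le (abs_infDist_sub_le _ x y) ((hbL _ _).trans (hρ x y)))
  · have : ∀ z, ρ z ∉ Ioo (Δ / 16) Δ → ∀ ω, F ω z = 0 := fun z hz ω => by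
      simp only [F, hbout _ hz]
      exact min_eq_right infDist_nonneg
    simp [meanSq, this x hx, this y hy]
  · refine le_meanSq (by positivity) (s := Finset.univ.filter fun ω =>
      y ∈ Z ω ∧ ∀ z ∈ Z ω, Δ / (4 * α) ≤ dist x z) (by exact_mod_cast hZ x y hxy) fun ω hω => ?_
    obtain ⟨hy, hfar⟩ := (Finset.mem_filter.1 hω).2
    have hα' : (1 : ℝ) ≤ α := by exact_mod_cast hα
    have h1 : Δ / (16 * α) ≤ Δ / 16 := by gcongr; linarith
    have h2 : Δ / (16 * α) ≤ Δ / (4 * α) := by gcongr; norm_num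
    have hFy : F ω y = 0 := by
      simp only [F, infDist_zero_of_mem hy]
      exact min_eq_left (hb0 _)
    rw [hFy, sub_zero]
    refine le_trans (le_min ?_ ?_) (le_abs_self _)
    · exact (le_infDist ⟨y, hy⟩).2 fun {z} hz => h2.trans (hfar z hz)
    · refine le_max_of_le_right (le_min ?_ ?_)
      · linarith [hx.1]
      · linarith [hx.2]

lemma card_scales_le (U : Finset ℤ) (r : ℝ) :
    (U.filter fun u => r ∈ Ioo ((2 : ℝ) ^ u / 16) (2 ^ u)).card ≤ 4 := by
  rcases le_or_gt r 0 with hr | hr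
  · rw [Finset.filter_false_of_mem]
    · simp
    · rintro u - ⟨h, -⟩
      have : (0 : ℝ) < 2 ^ u / 16 := by positivity
      linarith
  · have h1 : ((2 : ℕ) : ℝ) ^ Int.log 2 r ≤ r := Int.zpow_log_le_self (by norm_num) hr
    have h2 : r < ((2 : ℕ) : ℝ) ^ (Int.log 2 r + 1) := Int.lt_zpow_succ_log_self (by norm_num) r
    push_cast at h1 h2
    refine (Finset.card_le_card (t := Finset.Ioo (Int.log 2 r) (Int.log 2 r + 5)) ?_).trans
      (by simp)
    intro u hu
    obtain ⟨h3, h4⟩ := (Finset.mem_filter.1 hu).2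
    rw [Finset.mem_Ioo]
    constructor
    · exact (zpow_lt_zpow_iff_right₀ (by norm_num : (1 : ℝ) < 2)).1 (h1.trans_lt h4)
    · refine (zpow_lt_zpow_iff_right₀ (by norm_num : (1 : ℝ) < 2)).1 ?_
      have : (2 : ℝ) ^ (Int.log 2 r + 5) = 2 ^ (Int.log 2 r + 1) * 16 := by
        rw [show Int.log 2 r + 5 = Int.log 2 r + 1 + 4 by ring, zpow_add₀ two_ne_zero]
        norm_num
      rw [this]
      linarith

/-- Padded cuts at every scale, localized by a Lipschitz function `ρ`. -/
lemma exists_isHilbertSq_localized {α : ℕ} (hα : 1 ≤ α)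
    (hpad : HasPaddedCuts (dist : V → V → ℝ) α) {ρ : V → ℝ}
    (hρ : ∀ x y, |ρ x - ρ y| ≤ dist x y) :
    ∃ E : V → V → ℝ, IsHilbertSq E ∧ (∀ x y, E x y ≤ 8 * dist x y ^ 2) ∧
      ∀ x y, 0 < dist x y → ρ x ∈ Icc (dist x y / 8) (dist x y / 4) →
        (dist x y / (32 * α)) ^ 2 / 16 ≤ E x y := by
  classical
  have hscale : ∀ u : ℤ, (0 : ℝ) < 2 ^ u := fun u => by positivity
  choose E hE hle hzero hlow using fun u => exists_isHilbertSq_scale hα hpad (hscale u) hρ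
  let U : Finset ℤ := Finset.univ.image fun p : V × V => Int.log 2 (dist p.1 p.2)
  refine ⟨fun x y => ∑ u ∈ U, E u x y, IsHilbertSq.sum U fun u _ => hE u, fun x y => ?_,
    fun x y hxy hx => ?_⟩
  · let W : V → Finset ℤ := fun z => U.filter fun u => ρ z ∈ Ioo ((2 : ℝ) ^ u / 16) (2 ^ u)
    have hsub : ∑ u ∈ U, E u x y = ∑ u ∈ W x ∪ W y, E u x y := by
      refine (Finset.sum_subset (Finset.union_subset (Finset.filter_subset _ _)
        (Finset.filter_subset _ _)) fun u hu hu' => ?_).symm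
      simp only [Finset.mem_union, Finset.mem_filter, hu, true_and, not_or] at hu'
      exact hzero u x y hu'.1 hu'.2
    have hcard : (W x ∪ W y).card ≤ 8 :=
      (Finset.card_union_le _ _).trans
        (Nat.add_le_add (card_scales_le U (ρ x)) (card_scales_le U (ρ y)))
    have hcard' : ((W x ∪ W y).card : ℝ) ≤ 8 := by exact_mod_cast hcard
    calc ∑ u ∈ U, E u x y = ∑ u ∈ W x ∪ W y, E u x y := hsub
      _ ≤ ∑ _u ∈ W x ∪ W y, dist x y ^ 2 := Finset.sum_le_sum fun u _ => hle u x y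
      _ = (W x ∪ W y).card * dist x y ^ 2 := by simp
      _ ≤ 8 * dist x y ^ 2 := by gcongr
  · have h1 : ((2 : ℕ) : ℝ) ^ Int.log 2 (dist x y) ≤ dist x y :=
      Int.zpow_log_le_self (by norm_num) hxy
    have h2 : dist x y < ((2 : ℕ) : ℝ) ^ (Int.log 2 (dist x y) + 1) :=
      Int.lt_zpow_succ_log_self (by norm_num) _
    rw [zpow_add₀ (by norm_num), zpow_one] at h2
    push_cast at h1 h2
    set u := Int.log 2 (dist x y) with hu
    have hα' : (1 : ℝ) ≤ α := by exact_mod_cast hα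
    calc (dist x y / (32 * α)) ^ 2 / 16 ≤ (2 ^ u / (16 * α)) ^ 2 / 16 := by
          have : dist x y / (32 * α) ≤ 2 ^ u / (16 * α) := by
            rw [div_le_div_iff₀ (by positivity) (by positivity)]
            nlinarith
          gcongr
      _ ≤ E u x y := hlow u x y h1 ⟨by linarith [hx.1], by linarith [hx.2]⟩
      _ ≤ ∑ u ∈ U, E u x y := Finset.single_le_sum (f := fun u => E u x y)
          (fun u _ => (hE u).nonneg x y)
          (Finset.mem_image.2 ⟨(x, y), Finset.mem_univ _, rfl⟩)

/-- Consecutive growth radii of the pair `x, y` between `dist x y / 8` and `dist x y / 4` have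
total length `dist x y / 8`, and all but the last nontrivial one record growth around `x`. -/
lemma exists_growth_gaps {L : ℕ} (hL : Fintype.card V < 2 ^ L) {x y : V} (hd : 0 < dist x y)
    (hxy : ballCard x (dist x y / 8) ≤ ballCard y (dist x y / 8)) :
    ∃ gap : ℕ → ℝ, (∀ t, 0 ≤ gap t) ∧ ∑ t ∈ Finset.range L, gap t = dist x y / 8 ∧
      ∀ t, 0 < gap t →
        (∃ r s, s ≤ r ∧ r + s < dist x y ∧ r - s = gap t / 2 ∧
          (2 ^ t ≤ ballCard y s ∧ ballCard x r < 2 ^ (t + 1) ∨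
            2 ^ t ≤ ballCard x s ∧ ballCard y r < 2 ^ (t + 1))) ∧
        ballCard x (dist x y / 8) < 2 ^ (t + 1) ∧ 2 ^ t ≤ ballCard x (dist x y / 4) := by
  set d := dist x y
  let m : ℝ → ℕ := fun r => min (ballCard x r) (ballCard y r)
  have hm : Monotone m := (ballCard_mono x).min (ballCard_mono y)
  let S : ℕ → Set ℝ := fun t => {r | d / 8 ≤ r ∧ (d / 4 ≤ r ∨ 2 ^ t ≤ m r)}
  have hbdd : ∀ t, BddBelow (S t) := fun t => ⟨d / 8, fun _ hr => hr.1⟩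
  have hmem : ∀ t, d / 4 ∈ S t := fun t => ⟨by linarith, Or.inl le_rfl⟩
  let τ : ℕ → ℝ := fun t => sInf (S t)
  have hle : ∀ t, τ t ≤ d / 4 := fun t => csInf_le (hbdd t) (hmem t)
  have hge : ∀ t, d / 8 ≤ τ t := fun t => le_csInf ⟨_, hmem t⟩ fun r hr => hr.1
  have hmono : ∀ t, τ t ≤ τ (t + 1) := fun t =>
    csInf_le_csInf (hbdd t) ⟨_, hmem (t + 1)⟩ fun r hr =>
      ⟨hr.1, hr.2.imp_right (le_trans (Nat.pow_le_pow_right two_pos (Nat.le_succ t)))⟩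
  have h0 : τ 0 = d / 8 :=
    le_antisymm (csInf_le (hbdd 0) ⟨le_rfl, Or.inr (le_min (one_le_ballCard x (by positivity))
      (one_le_ballCard y (by positivity)))⟩) (hge 0)
  have hLast : τ L = d / 4 :=
    le_antisymm (hle L) (le_csInf ⟨_, hmem L⟩ fun r hr => hr.2.resolve_right fun h =>
      absurd (h.trans ((min_le_left _ _).trans (ballCard_le_card x r))) (not_le.2 hL))
  refine ⟨fun t => τ (t + 1) - τ t, fun t => sub_nonneg.2 (hmono t), ?_, fun t ht => ?_⟩
  · rw [Finset.sum_range_sub, hLast, h0]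
    ring
  have hlt : ∀ r, d / 8 ≤ r → r < τ (t + 1) → m r < 2 ^ (t + 1) := by
    intro r hr hr'
    by_contra! h
    exact absurd (csInf_le (hbdd (t + 1)) ⟨hr, Or.inr h⟩) (not_le.2 hr')
  have hgt : ∀ s, τ t < s → s < d / 4 → 2 ^ t ≤ m s := by
    intro s hs hs'
    obtain ⟨r, hr, hrs⟩ := exists_lt_of_csInf_lt ⟨_, hmem t⟩ hs
    exact (hr.2.resolve_left (not_le.2 (hrs.trans hs'))).trans (hm hrs.le)
  set g := τ (t + 1) - τ t with hg
  have h1 := hge t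
  have h2 := hle (t + 1)
  have hr := hlt (τ (t + 1) - g / 4) (by linarith) (by linarith)
  have hs := hgt (τ t + g / 4) (by linarith) (by linarith)
  refine ⟨⟨τ (t + 1) - g / 4, τ t + g / 4, by linarith, by linarith, by linarith, ?_⟩, ?_, ?_⟩
  · obtain ⟨hsx, hsy⟩ := le_min_iff.1 hs
    exact (min_lt_iff.1 hr).imp (fun h => ⟨hsy, h⟩) (fun h => ⟨hsx, h⟩)
  · have := hlt (d / 8) le_rfl (by linarith)
    rwa [show m (d / 8) = _ from min_eq_left hxy] at this
  · exact (le_min_iff.1 hs).1.trans (ballCard_mono x (by linarith))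

/-- A finite pseudometric space with padded cuts embeds into Hilbert space, with distortion
controlled by the padding parameter and the logarithm of the number of points. -/
theorem exists_isHilbertSq_of_hasPaddedCuts {α : ℕ} (hα : 1 ≤ α)
    (hpad : HasPaddedCuts (dist : V → V → ℝ) α) {L : ℕ} (hL : Fintype.card V < 2 ^ L) :
    ∃ E : V → V → ℝ, IsHilbertSq E ∧
      ∀ x y, dist x y ^ 2 / (2 ^ 14 * α) ≤ E x y ∧ E x y ≤ 9 * L * dist x y ^ 2 := by
  choose A hA hAle hAlow using exists_isHilbertSq_growth V
  choose B hB hBle hBlow using fun k =>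
    exists_isHilbertSq_localized hα hpad (abs_critRadius_sub_le (V := V) k)
  have hE : IsHilbertSq fun x y =>
      ∑ t ∈ Finset.range L, (A t x y + B (2 ^ (t + 1)) x y) :=
    IsHilbertSq.sum _ fun t _ => (hA t).add (hB _)
  refine ⟨_, hE, fun x y => ⟨?_, ?_⟩⟩
  · wlog hxy : ballCard x (dist x y / 8) ≤ ballCard y (dist x y / 8) generalizing x y
    · rw [hE.symm, dist_comm]
      rw [dist_comm] at hxy
      exact this y x (not_le.1 hxy).le
    rcases dist_nonneg.eq_or_lt' (a := dist x y) with hd | hd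
    · rw [hd]
      simpa using hE.nonneg x y
    obtain ⟨gap, hgap0, hgapsum, hgap⟩ := exists_growth_gaps hL hd hxy
    set d := dist x y
    have hα' : (1 : ℝ) ≤ α := by exact_mod_cast hα
    have hsym : ∀ t, A t x y = A t y x := fun t => (hA t).symm x y
    let S := (Finset.range L).filter fun t => 0 < gap t
    have hAgap : ∀ t ∈ S, gap t ^ 2 / 64 ≤ A t x y := by
      intro t ht
      obtain ⟨⟨r, s, hsr, hrs, hg, h⟩, -⟩ := hgap t (Finset.mem_filter.1 ht).2
      have : gap t ^ 2 / 64 = (r - s) ^ 2 / 16 := by rw [hg]; ring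
      rw [this]
      rcases h with ⟨h1, h2⟩ | ⟨h1, h2⟩
      · exact hAlow t x y r s hsr hrs h1 h2
      · rw [hsym]
        exact hAlow t y x r s hsr (by rwa [dist_comm]) h1 h2
    have hSsum : ∑ t ∈ S, gap t = d / 8 := by
      rw [← hgapsum]
      exact Finset.sum_filter_of_ne fun t _ h => lt_of_le_of_ne (hgap0 t) h.symm
    have hsplit : ∑ t ∈ S, A t x y + ∑ t ∈ S, B (2 ^ (t + 1)) x y ≤
        ∑ t ∈ Finset.range L, (A t x y + B (2 ^ (t + 1)) x y) := by
      rw [← Finset.sum_add_distrib]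
      exact Finset.sum_le_sum_of_subset_of_nonneg (Finset.filter_subset _ _) fun t _ _ =>
        add_nonneg ((hA t).nonneg x y) ((hB _).nonneg x y)
    refine le_trans ?_ hsplit
    have hSne : S.Nonempty := by
      by_contra h
      rw [Finset.not_nonempty_iff_eq_empty.1 h] at hSsum
      simp only [Finset.sum_empty] at hSsum
      linarith
    have hAnn : 0 ≤ ∑ t ∈ S, A t x y := Finset.sum_nonneg fun t _ => (hA t).nonneg x y
    have hBnn : 0 ≤ ∑ t ∈ S, B (2 ^ (t + 1)) x y :=
      Finset.sum_nonneg fun t _ => (hB _).nonneg x y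
    rcases le_or_gt S.card (2 * α) with hS | hS
    · have hcs : (d / 8) ^ 2 ≤ S.card * ∑ t ∈ S, gap t ^ 2 := by
        rw [← hSsum]
        exact sq_sum_le_card_mul_sum_sq
      have hS' : (S.card : ℝ) ≤ 2 * α := by exact_mod_cast hS
      have hle : ∑ t ∈ S, gap t ^ 2 / 64 ≤ ∑ t ∈ S, A t x y := Finset.sum_le_sum hAgap
      rw [← Finset.sum_div] at hle
      have : (0 : ℝ) ≤ ∑ t ∈ S, gap t ^ 2 := by positivity
      rw [div_le_iff₀ (by positivity)]
      nlinarith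
    · have hterm : ∀ t ∈ S.erase (S.max' hSne),
          (d / (32 * α)) ^ 2 / 16 ≤ B (2 ^ (t + 1)) x y := by
        intro t ht
        have htS := Finset.mem_of_mem_erase ht
        have hlast := S.max'_mem hSne
        have hlt : t < S.max' hSne :=
          lt_of_le_of_ne (S.le_max' t htS) (Finset.ne_of_mem_erase ht)
        refine hBlow _ x y hd (critRadius_mem_Icc (by positivity)
          (hgap t (Finset.mem_filter.1 htS).2).2.1 ?_)
        exact (Nat.pow_le_pow_right two_pos hlt).trans
          (hgap _ (Finset.mem_filter.1 hlast).2).2.2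
      have hcard : α ≤ (S.erase (S.max' hSne)).card := by
        rw [Finset.card_erase_of_mem (S.max'_mem hSne)]
        omega
      have hcard' : (α : ℝ) ≤ (S.erase (S.max' hSne)).card := by exact_mod_cast hcard
      calc d ^ 2 / (2 ^ 14 * α) = α * ((d / (32 * α)) ^ 2 / 16) := by field_simp; norm_num
        _ ≤ (S.erase (S.max' hSne)).card * ((d / (32 * α)) ^ 2 / 16) := by gcongr
        _ = ∑ t ∈ S.erase (S.max' hSne), (d / (32 * α)) ^ 2 / 16 := by simp
        _ ≤ ∑ t ∈ S.erase (S.max' hSne), B (2 ^ (t + 1)) x y := Finset.sum_le_sum hterm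
        _ ≤ ∑ t ∈ S, B (2 ^ (t + 1)) x y :=
          Finset.sum_le_sum_of_subset_of_nonneg (Finset.erase_subset _ _) fun t _ _ =>
            (hB _).nonneg x y
        _ ≤ _ := le_add_of_nonneg_left hAnn
  · calc ∑ t ∈ Finset.range L, (A t x y + B (2 ^ (t + 1)) x y)
        ≤ ∑ t ∈ Finset.range L, 9 * dist x y ^ 2 :=
          Finset.sum_le_sum fun t _ => by linarith [hAle t x y, hBle (2 ^ (t + 1)) x y]
      _ = 9 * L * dist x y ^ 2 := by
          rw [Finset.sum_const, Finset.card_range, nsmul_eq_mul]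
          ring

end MeasuredDescent

section Numerics

lemma one_lt_log_three : 1 < Real.log 3 :=
  (Real.lt_log_iff_exp_lt (by norm_num)).2 (Real.exp_one_lt_d9.trans (by norm_num))

lemma natLog_two_add_one_le {n : ℕ} (hn : 3 ≤ n) :
    ((Nat.log 2 n + 1 : ℕ) : ℝ) ≤ 3 * Real.log n := by
  have h1 : (2 : ℝ) ^ Nat.log 2 n ≤ n := by exact_mod_cast Nat.pow_log_le_self 2 (by omega)
  have h2 := Real.log_le_log (by positivity) h1
  rw [Real.log_pow] at h2
  have h3 : Real.log 3 ≤ Real.log n :=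
    Real.log_le_log (by norm_num) (by exact_mod_cast hn)
  have h4 := Real.log_two_gt_d9
  have h5 := one_lt_log_three
  have h6 : (0 : ℝ) ≤ Nat.log 2 n := Nat.cast_nonneg _
  push_cast
  nlinarith

lemma clog_two_add_one_le {K : ℕ} (hK : 1 ≤ K) {y : ℝ} (hy : K ≤ 6 * y) :
    ((Nat.clog 2 (2 * K) + 1 : ℕ) : ℝ) ≤ 11 + 2 * Real.log y := by
  set m := Nat.clog 2 (2 * K)
  have hK' : (1 : ℝ) ≤ K := by exact_mod_cast hK
  have hy0 : 0 < y := by linarith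
  have h1 : 2 ^ (m - 1) < 2 * K := Nat.pow_pred_clog_lt_self (by norm_num) (by omega)
  have hm : 1 ≤ m := Nat.clog_pos (by norm_num) (by omega)
  have h2 : (2 : ℝ) ^ m ≤ 2 ^ 5 * y := by
    have : (2 : ℝ) ^ (m - 1) < 2 * K := by exact_mod_cast h1
    have h3 : (2 : ℝ) ^ m = 2 ^ (m - 1) * 2 := by rw [← pow_succ, Nat.sub_add_cancel hm]
    linarith
  have h3 := Real.log_le_log (by positivity) h2
  rw [Real.log_mul (by positivity) hy0.ne', Real.log_pow, Real.log_pow] at h3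
  have h4 := Real.log_two_gt_d9
  have h5 := Real.log_two_lt_d9
  have hlogy : -Real.log 2 * 3 ≤ Real.log y := by
    have : Real.log ((2 : ℝ) ^ 3)⁻¹ ≤ Real.log y :=
      Real.log_le_log (by positivity) (by norm_num; linarith)
    rw [Real.log_inv, Real.log_pow] at this
    push_cast at this
    linarith
  push_cast at h3 ⊢
  nlinarith

lemma exists_log_bound : ∃ κ : ℝ, 0 < κ ∧ ∀ n t : ℕ, 3 ≤ n → 1 ≤ t →
    ((Nat.log 2 n + 1 : ℕ) : ℝ) * (Nat.clog 2 (2 * ((t + 1) * (Nat.log 2 n + 1))) + 1 : ℕ) ≤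
      κ * (Real.log (t * Real.log n) * Real.log n) := by
  have hpos : 0 < Real.log (Real.log 3) := Real.log_pos one_lt_log_three
  refine ⟨3 * (11 / Real.log (Real.log 3) + 2), by positivity, fun n t hn ht => ?_⟩
  have hL := natLog_two_add_one_le hn
  have ht' : (1 : ℝ) ≤ t := by exact_mod_cast ht
  have h3 : Real.log 3 ≤ Real.log n :=
    Real.log_le_log (by norm_num) (by exact_mod_cast hn)
  have hlog := one_lt_log_three
  have hα := clog_two_add_one_le (K := (t + 1) * (Nat.log 2 n + 1)) (y := t * Real.log n)
    (Nat.mul_pos (by omega) (by omega)) (by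
      rw [Nat.cast_mul]
      calc ((t + 1 : ℕ) : ℝ) * (Nat.log 2 n + 1 : ℕ) ≤ (2 * t) * (3 * Real.log n) := by
            gcongr
            push_cast
            linarith
        _ = 6 * (t * Real.log n) := by ring)
  have hy : Real.log (Real.log 3) ≤ Real.log (t * Real.log n) :=
    Real.log_le_log (by linarith) (by nlinarith)
  have h11 : 11 + 2 * Real.log (t * Real.log n) ≤
      (11 / Real.log (Real.log 3) + 2) * Real.log (t * Real.log n) := by
    have : 11 ≤ 11 / Real.log (Real.log 3) * Real.log (t * Real.log n) := by
      rw [div_mul_eq_mul_div, le_div_iff₀ hpos]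
      linarith
    linarith
  calc _ ≤ 3 * Real.log n *
        ((11 / Real.log (Real.log 3) + 2) * Real.log (t * Real.log n)) := by
        gcongr
        exact hα.trans h11
    _ = _ := by ring

end Numerics

/-- Two-sided bounds on the squared distances of a Hilbertian pseudometric bound the distortion. -/
lemma IsHilbertSq.embedsInHilbertWithDistortion {V : Type} {E d : V → V → ℝ} (hE : IsHilbertSq E)
    (hd : ∀ x y, 0 ≤ d x y) {a b D : ℝ} (ha : 0 < a) (hD : 0 ≤ D) (hab : b ≤ a * D ^ 2)
    (h : ∀ x y, a * d x y ^ 2 ≤ E x y ∧ E x y ≤ b * d x y ^ 2) :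
    EmbedsInHilbertWithDistortion d D := by
  obtain ⟨J, _, f, hf⟩ := hE.exists_map
  refine ⟨EuclideanSpace ℝ J, inferInstance, inferInstance, inferInstance, f, Real.sqrt a,
    Real.sqrt_pos.2 ha, fun x y => ?_⟩
  have hsq := Real.sq_sqrt ha.le
  rw [hf]
  constructor
  · refine Real.le_sqrt_of_sq_le ?_
    rw [mul_pow, hsq]
    exact (h x y).1
  · refine Real.sqrt_le_iff.2 ⟨mul_nonneg (by positivity) (hd x y), (h x y).2.trans ?_⟩
    rw [mul_pow, mul_pow, hsq]
    gcongr

/-- Every connected graph of treewidth `t ≥ 1` on `n ≥ 3` vertices, with arbitrary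
nonnegative edge weights, embeds into a Hilbert space with distortion
`O(√(ln(t ln n) · ln n))`. -/
theorem treewidth_embedsInHilbert :
    ∃ C : ℝ, 0 < C ∧
      ∀ (V : Type) [Fintype V], ∀ (G : SimpleGraph V) (w : Sym2 V → ℝ),
        (∀ e, 0 ≤ w e) → G.Connected → 3 ≤ Fintype.card V →
        ∀ t : ℕ, 1 ≤ t → treewidth G = t →
        EmbedsInHilbertWithDistortion (graphDist G w)
          (C * Real.sqrt (Real.log ((t : ℝ) * Real.log (Fintype.card V)) *
            Real.log (Fintype.card V))) := by
  obtain ⟨κ, hκ, hlog⟩ := exists_log_bound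
  refine ⟨Real.sqrt (9 * 2 ^ 14 * κ), by positivity, fun V _ G w hw hG hn t ht htw => ?_⟩
  have hwidth : HasTreewidthLE G t := by
    rw [← htw]
    refine Nat.sInf_mem (s := {t | HasTreewidthLE G t})
      (Set.nonempty_iff_ne_empty.2 fun h => ?_)
    rw [treewidth, h, Nat.sInf_empty] at htw
    omega
  obtain ⟨rk, hrk, hreach⟩ := hwidth.exists_injective_ranking
  have hpad := hasPaddedCuts_of_ranking hw hG hrk
    (m := Nat.clog 2 (2 * ((t + 1) * (Nat.log 2 (Fintype.card V) + 1)))) fun x =>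
      (Nat.mul_le_mul_left 2 (hreach x)).trans (Nat.le_pow_clog (by norm_num) _)
  let _ := graphPseudoMetricSpace hw hG
  obtain ⟨E, hE, hbound⟩ := exists_isHilbertSq_of_hasPaddedCuts (Nat.le_add_left 1 _) hpad
    (Nat.lt_pow_succ_log_self one_lt_two (Fintype.card V))
  have hκn := hlog (Fintype.card V) t hn ht
  set α := Nat.clog 2 (2 * ((t + 1) * (Nat.log 2 (Fintype.card V) + 1))) + 1
  set L := Nat.log 2 (Fintype.card V) + 1
  set Q := Real.log (t * Real.log (Fintype.card V)) * Real.log (Fintype.card V)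
  have hα : (0 : ℝ) < α := by positivity
  have hQ : 0 ≤ Q := nonneg_of_mul_nonneg_right ((by positivity : (0 : ℝ) ≤ L * α).trans hκn) hκ
  refine hE.embedsInHilbertWithDistortion (graphDist_nonneg hw) (a := 1 / (2 ^ 14 * α))
    (b := 9 * L) (by positivity) (by positivity) ?_ fun x y => ?_
  · rw [mul_pow, Real.sq_sqrt (by positivity), Real.sq_sqrt hQ, div_mul_eq_mul_div,
      le_div_iff₀ (by positivity)]
    linarith
  · rw [div_mul_eq_mul_div, one_mul]
    exact hbound x y
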